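/- arXiv:1909.05292 — 4 statements merged into one kernel-verified Lean document; each statement's English description precedes it below -/
import Mathlib

section
/- Let A ∈ GL(2,ℤ) be an Anosov matrix. Then the canonical subgroup ℤ × ℤ of E_A is characteristic: every automorphism of E_A maps the subgroup ℤ × ℤ onto itself. -/
open Matrix SemidirectProduct Multiplicative

abbrev GL2Z := GL (Fin 2) ℤ

/-- A matrix in `GL(2,ℤ)` is exceptional if `det = 1` and `|tr| ≤ 2`, or `det = -1` and `tr = 0`. -/
def IsExceptional (A : GL2Z) : Prop :=
  ((A : Matrix (Fin 2) (Fin 2) ℤ).det = 1 ∧ |(A : Matrix (Fin 2) (Fin 2) ℤ).trace| ≤ 2) ∨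
    ((A : Matrix (Fin 2) (Fin 2) ℤ).det = -1 ∧ (A : Matrix (Fin 2) (Fin 2) ℤ).trace = 0)

/-- Anosov = not exceptional. -/
def IsAnosov (A : GL2Z) : Prop := ¬ IsExceptional A

/-- The linear action of a 2×2 integer matrix on `ℤ × ℤ`. -/
def mulVec2 (M : Matrix (Fin 2) (Fin 2) ℤ) (p : ℤ × ℤ) : ℤ × ℤ :=
  (M 0 0 * p.1 + M 0 1 * p.2, M 1 0 * p.1 + M 1 1 * p.2)

lemma mulVec2_one (p : ℤ × ℤ) : mulVec2 1 p = p := by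
  simp [mulVec2, Matrix.one_apply]

lemma mulVec2_mul (M N : Matrix (Fin 2) (Fin 2) ℤ) (p : ℤ × ℤ) :
    mulVec2 (M * N) p = mulVec2 M (mulVec2 N p) := by
  apply Prod.ext <;>
    simp only [mulVec2, Matrix.mul_apply, Fin.sum_univ_two] <;> ring

/-- `mulVec2 M` as an additive monoid homomorphism. -/
def mulVec2Hom (M : Matrix (Fin 2) (Fin 2) ℤ) : (ℤ × ℤ) →+ (ℤ × ℤ) where
  toFun := mulVec2 M
  map_zero' := by simp [mulVec2]
  map_add' p q := by
    apply Prod.ext <;> simp only [mulVec2, Prod.fst_add, Prod.snd_add] <;> ring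

/-- The additive automorphism of `ℤ × ℤ` given by an element of `GL(2,ℤ)`. -/
def glAddAut (A : GL2Z) : AddAut (ℤ × ℤ) where
  toFun := mulVec2 (A : Matrix (Fin 2) (Fin 2) ℤ)
  invFun := mulVec2 ((A⁻¹ : GL2Z) : Matrix (Fin 2) (Fin 2) ℤ)
  left_inv p := by
    rw [← mulVec2_mul]
    rw [show ((A⁻¹ : GL2Z) : Matrix (Fin 2) (Fin 2) ℤ) * (A : Matrix (Fin 2) (Fin 2) ℤ) = 1 from
      A.inv_mul]
    exact mulVec2_one p
  right_inv p := by
    rw [← mulVec2_mul]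
    rw [show (A : Matrix (Fin 2) (Fin 2) ℤ) * ((A⁻¹ : GL2Z) : Matrix (Fin 2) (Fin 2) ℤ) = 1 from
      A.mul_inv]
    exact mulVec2_one p
  map_add' := (mulVec2Hom (A : Matrix (Fin 2) (Fin 2) ℤ)).map_add

/-- The multiplicative automorphism of `Multiplicative (ℤ × ℤ)` given by an element of
`GL(2,ℤ)`. -/
def glMulAut (A : GL2Z) : MulAut (Multiplicative (ℤ × ℤ)) :=
  AddEquiv.toMultiplicative (glAddAut A)

/-- The action of `ℤ` on `ℤ × ℤ` in which `1` acts by the matrix `A`. -/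
def EAphi (A : GL2Z) : Multiplicative ℤ →* MulAut (Multiplicative (ℤ × ℤ)) :=
  zpowersHom _ (glMulAut A)

/-- `E_A = (ℤ × ℤ) ⋊ ℤ`, where `1 : ℤ` acts by the matrix `A`. -/
abbrev EA (A : GL2Z) : Type :=
  Multiplicative (ℤ × ℤ) ⋊[EAphi A] Multiplicative ℤ

/-- The canonical subgroup `ℤ × ℤ` of `E_A`. -/
def EAsub (A : GL2Z) : Subgroup (EA A) :=
  (SemidirectProduct.inl : Multiplicative (ℤ × ℤ) →* EA A).range

/-- An Anosov matrix does not have `1` as an eigenvalue. -/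
lemma IsAnosov.one_sub_trace_add_det_ne_zero {A : GL2Z} (hA : IsAnosov A) :
    1 - (A : Matrix (Fin 2) (Fin 2) ℤ).trace + (A : Matrix (Fin 2) (Fin 2) ℤ).det ≠ 0 := by
  intro h
  have hdet : IsUnit (A : Matrix (Fin 2) (Fin 2) ℤ).det :=
    (Matrix.isUnit_iff_isUnit_det _).1 A.isUnit
  rcases Int.isUnit_iff.1 hdet with hd | hd
  · refine hA (Or.inl ⟨hd, ?_⟩)
    rw [abs_le]
    constructor <;> linarith
  · exact hA (Or.inr ⟨hd, by linarith⟩)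

/-- For Anosov `A`, an `A`-invariant additive map `ℤ × ℤ → ℤ` vanishes. -/
lemma IsAnosov.eq_zero_of_invariant {A : GL2Z} (hA : IsAnosov A) (h : (ℤ × ℤ) →+ ℤ)
    (hinv : ∀ v, h (mulVec2 (A : Matrix (Fin 2) (Fin 2) ℤ) v) = h v) : h = 0 := by
  have hcoord (x y : ℤ) : h (x, y) = x * h (1, 0) + y * h (0, 1) := by
    rw [← smul_eq_mul, ← smul_eq_mul, ← map_zsmul, ← map_zsmul, ← map_add]
    simp
  have hne := hA.one_sub_trace_add_det_ne_zero
  have h₁ := hinv (1, 0)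
  have h₂ := hinv (0, 1)
  simp only [mulVec2, mul_one, mul_zero, add_zero, zero_add] at h₁ h₂
  rw [hcoord] at h₁ h₂
  rw [Matrix.trace_fin_two, Matrix.det_fin_two] at hne
  generalize (A : Matrix (Fin 2) (Fin 2) ℤ) = M at *
  have ha : h (1, 0) = 0 := by
    refine (mul_eq_zero.1 ?_).resolve_left hne
    linear_combination (M 1 1 - 1) * h₁ - M 1 0 * h₂
  have hb : h (0, 1) = 0 := by
    refine (mul_eq_zero.1 ?_).resolve_left hne
    linear_combination (M 0 0 - 1) * h₂ - M 0 1 * h₁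
  refine AddMonoidHom.ext fun ⟨x, y⟩ => ?_
  simp [hcoord x y, ha, hb]

/-- For Anosov `A`, every homomorphism `E_A → ℤ` is trivial on the canonical subgroup. -/
lemma IsAnosov.map_inl_eq_one {A : GL2Z} (hA : IsAnosov A) (f : EA A →* Multiplicative ℤ)
    (v : Multiplicative (ℤ × ℤ)) : f (inl v) = 1 := by
  have hinv (w : ℤ × ℤ) :
      f (inl (ofAdd (mulVec2 (A : Matrix (Fin 2) (Fin 2) ℤ) w))) = f (inl (ofAdd w)) := by
    have hact : EAphi A (ofAdd 1) (ofAdd w) =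
        ofAdd (mulVec2 (A : Matrix (Fin 2) (Fin 2) ℤ) w) := by
      simp only [EAphi, zpowersHom_apply, toAdd_ofAdd, zpow_one]
      rfl
    rw [← hact, inl_aut, map_mul, map_mul, mul_right_comm, map_inv, map_inv,
      mul_inv_cancel, one_mul]
  exact DFunLike.congr_fun
    (hA.eq_zero_of_invariant (AddMonoidHom.toMultiplicative.symm (f.comp inl)) hinv) v.toAdd

/-- For an Anosov matrix `A ∈ GL(2,ℤ)`, the canonical subgroup `ℤ × ℤ` of `E_A`
is characteristic: every automorphism of `E_A` maps it onto itself. -/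
theorem stmt0 (A : GL2Z) (hA : IsAnosov A) : (EAsub A).Characteristic := by
  refine Subgroup.characteristic_iff_map_le.2 fun σ => ?_
  rintro _ ⟨_, ⟨v, rfl⟩, rfl⟩
  rw [EAsub, range_inl_eq_ker_rightHom]
  exact hA.map_inl_eq_one (rightHom.comp σ.toMonoidHom) v
end

section
/- Let A ∈ GL(2,ℤ) be an Anosov matrix and let M₀ ∈ GL(2,ℤ) be a primitive root of A, i.e. C(A) = {± M₀^ℓ : ℓ ∈ ℤ}. Then Aut₀(E_A) is isomorphic to the iterated semidirect product ((ℤ × ℤ) ⋊ ℤ) ⋊ ℤ/2, where 1 ∈ ℤ acts on ℤ × ℤ by the matrix M₀, and the nontrivial element of ℤ/2 acts on (ℤ × ℤ) ⋊ ℤ by (m, n, t) ↦ (−m, −n, t). -/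
open Matrix SemidirectProduct Multiplicative

/-- The subgroup of `Aut(E_A)` of automorphisms mapping the canonical `ℤ × ℤ` onto itself and
inducing the identity on the quotient `ℤ` (the quotient map being `rightHom`). -/
def Aut₀ (A : GL2Z) : Subgroup (MulAut (EA A)) where
  carrier := {e | (EAsub A).map e.toMonoidHom = EAsub A ∧
    ∀ g : EA A, rightHom (e g) = rightHom g}
  one_mem' := by
    constructor
    · have : ((1 : MulAut (EA A)).toMonoidHom) = MonoidHom.id (EA A) := rfl
      rw [this, Subgroup.map_id]
    · intro g; rfl
  mul_mem' := by
    intro a b ha hb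
    constructor
    · have : ((a * b : MulAut (EA A)).toMonoidHom) = a.toMonoidHom.comp b.toMonoidHom := rfl
      rw [this, ← Subgroup.map_map, hb.1, ha.1]
    · intro g
      have : (a * b : MulAut (EA A)) g = a (b g) := rfl
      rw [this, ha.2, hb.2]
  inv_mem' := by
    intro a ha
    have hcomp : (a⁻¹ : MulAut (EA A)).toMonoidHom.comp a.toMonoidHom = MonoidHom.id (EA A) := by
      refine MonoidHom.ext fun x => ?_
      show (a⁻¹ : MulAut (EA A)) (a x) = x
      simp
    constructor
    · conv_lhs => rw [← ha.1]
      rw [Subgroup.map_map, hcomp, Subgroup.map_id]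
    · intro g
      have := ha.2 ((a⁻¹ : MulAut (EA A)) g)
      have h2 : a ((a⁻¹ : MulAut (EA A)) g) = g := by simp
      rw [h2] at this
      exact this.symm

lemma EAphi_apply (A : GL2Z) (t : Multiplicative ℤ) :
    EAphi A t = glMulAut A ^ toAdd t := rfl

lemma EA_conj_inl (A : GL2Z) (x : EA A) (n : Multiplicative (ℤ × ℤ)) :
    x * inl n * x⁻¹ = inl (EAphi A x.right n) := by
  ext <;> simp [mul_comm]

/-- The centralizer of the automorphism of `ℤ × ℤ` given by `A`. -/
abbrev autCentralizer (A : GL2Z) : Subgroup (MulAut (Multiplicative (ℤ × ℤ))) :=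
  Subgroup.centralizer {glMulAut A}

/-- The group of affine maps of `ℤ × ℤ` whose linear part commutes with `A`. -/
abbrev AffCentralizer (A : GL2Z) : Type :=
  Multiplicative (ℤ × ℤ) ⋊[(autCentralizer A).subtype] autCentralizer A

/-- The endomorphism of `E_A` acting by the linear part of `x` on `ℤ × ℤ` and sending the
generator `1` of `ℤ` to its product with the translation part of `x`. -/
def affEnd (A : GL2Z) (x : AffCentralizer A) : EA A →* EA A :=
  SemidirectProduct.lift (inl.comp (x.right : MulAut _).toMonoidHom)
    (zpowersHom _ (inl x.left * inr (ofAdd 1))) <| by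
    intro g
    refine MonoidHom.ext fun n => ?_
    have hB : Commute (x.right : MulAut (Multiplicative (ℤ × ℤ))) (EAphi A g) :=
      Commute.zpow_right (Subgroup.mem_centralizer_singleton_iff.1 x.right.2) _
    have hr : ((zpowersHom (EA A) (inl x.left * inr (ofAdd 1))) g).right = g := by
      rw [← rightHom_eq_right, zpowersHom_apply, map_zpow]
      simp [← ofAdd_zsmul]
    have := DFunLike.congr_fun hB.eq n
    simp only [MulAut.mul_apply] at this
    simp only [MonoidHom.comp_apply, MulEquiv.coe_toMonoidHom, MulAut.conj_apply, EA_conj_inl, hr]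
    rw [this]

@[simp]
lemma affEnd_inl (A : GL2Z) (x : AffCentralizer A) (n : Multiplicative (ℤ × ℤ)) :
    affEnd A x (inl n) = inl ((x.right : MulAut _) n) := by
  simp [affEnd]

@[simp]
lemma affEnd_inr_one (A : GL2Z) (x : AffCentralizer A) :
    affEnd A x (inr (ofAdd 1)) = inl x.left * inr (ofAdd 1) := by
  simp [affEnd]

lemma EA_hom_ext {A : GL2Z} {f g : EA A →* EA A} (hl : ∀ n, f (inl n) = g (inl n))
    (hr : f (inr (ofAdd 1)) = g (inr (ofAdd 1))) : f = g :=
  SemidirectProduct.hom_ext (MonoidHom.ext hl) (MonoidHom.ext_mint hr)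

lemma affEnd_one (A : GL2Z) : affEnd A 1 = MonoidHom.id (EA A) :=
  EA_hom_ext (by simp) (by simp)

lemma affEnd_mul (A : GL2Z) (x y : AffCentralizer A) :
    affEnd A (x * y) = (affEnd A x).comp (affEnd A y) := by
  apply EA_hom_ext
  · intro n
    simp
  · rw [MonoidHom.comp_apply, affEnd_inr_one, affEnd_inr_one, map_mul, affEnd_inl,
      affEnd_inr_one, ← mul_assoc, ← map_mul, mul_comm _ x.left]
    rfl

/-- The action of `AffCentralizer A` on `E_A` by automorphisms. -/
def affAut (A : GL2Z) : AffCentralizer A →* MulAut (EA A) where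
  toFun x := MonoidHom.toMulEquiv (affEnd A x) (affEnd A x⁻¹)
    (by rw [← affEnd_mul, inv_mul_cancel, affEnd_one])
    (by rw [← affEnd_mul, mul_inv_cancel, affEnd_one])
  map_one' := MulEquiv.ext fun g => DFunLike.congr_fun (affEnd_one A) g
  map_mul' x y := MulEquiv.ext fun g => DFunLike.congr_fun (affEnd_mul A x y) g

@[simp]
lemma affAut_apply (A : GL2Z) (x : AffCentralizer A) (g : EA A) :
    affAut A x g = affEnd A x g := rfl

lemma EAsub_eq_ker (A : GL2Z) : EAsub A = (rightHom : EA A →* _).ker :=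
  range_inl_eq_ker_rightHom

lemma affAut_mem (A : GL2Z) (x : AffCentralizer A) : affAut A x ∈ Aut₀ A := by
  have h : ∀ (y : AffCentralizer A) (g : EA A), rightHom (affEnd A y g) = rightHom g := by
    intro y
    refine DFunLike.congr_fun (f := rightHom.comp (affEnd A y)) ?_
    exact SemidirectProduct.hom_ext (MonoidHom.ext (by simp)) (MonoidHom.ext_mint (by simp))
  refine ⟨?_, h x⟩
  rw [EAsub_eq_ker]
  ext g
  simp only [Subgroup.mem_map, MonoidHom.mem_ker]
  constructor
  · rintro ⟨g, hg, rfl⟩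
    exact (h x g).trans hg
  · intro hg
    refine ⟨(affAut A x⁻¹) g, (h x⁻¹ g).trans hg, ?_⟩
    change affAut A x (affAut A x⁻¹ g) = g
    rw [← MulAut.mul_apply, ← map_mul]
    simp

lemma affAut_injective (A : GL2Z) : Function.Injective (affAut A) := by
  intro x y hxy
  have h := DFunLike.congr_fun hxy
  simp only [affAut_apply] at h
  ext1
  · simpa using h (inr (ofAdd 1))
  · ext1
    ext1 n
    simpa using h (inl n)

lemma inl_left_of_mem_Aut₀ {A : GL2Z} {e : MulAut (EA A)} (he : e ∈ Aut₀ A)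
    (n : Multiplicative (ℤ × ℤ)) : inl (e (inl n)).left = e (inl n) := by
  have := he.2 (inl n)
  ext1
  · simp
  · simpa using this.symm

/-- The restriction to `ℤ × ℤ` of an automorphism in `Aut₀ A`. -/
def restrictAut {A : GL2Z} {e : MulAut (EA A)} (he : e ∈ Aut₀ A) :
    MulAut (Multiplicative (ℤ × ℤ)) where
  toFun n := (e (inl n)).left
  invFun n := (e⁻¹ (inl n)).left
  left_inv n := by simp [inl_left_of_mem_Aut₀ he]
  right_inv n := by
    simp only [inl_left_of_mem_Aut₀ (inv_mem he), MulAut.apply_inv_self, left_inl]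
  map_mul' m n := by
    apply inl_injective (φ := EAphi A)
    simp only [map_mul, inl_left_of_mem_Aut₀ he]
    rw [← map_mul, ← map_mul, inl_left_of_mem_Aut₀ he]

@[simp]
lemma inl_restrictAut {A : GL2Z} {e : MulAut (EA A)} (he : e ∈ Aut₀ A)
    (n : Multiplicative (ℤ × ℤ)) : inl (restrictAut he n) = e (inl n) :=
  inl_left_of_mem_Aut₀ he n

lemma restrictAut_mem {A : GL2Z} {e : MulAut (EA A)} (he : e ∈ Aut₀ A) :
    restrictAut he ∈ autCentralizer A := by
  rw [Subgroup.mem_centralizer_singleton_iff]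
  ext1 n
  apply inl_injective (φ := EAphi A)
  have h1 := EA_conj_inl A (inr (ofAdd 1)) n
  have h2 := EA_conj_inl A (e (inr (ofAdd 1))) (restrictAut he n)
  have hr : (e (inr (ofAdd 1))).right = ofAdd 1 := by simpa using he.2 (inr (ofAdd 1))
  rw [hr, inl_restrictAut, ← map_inv, ← map_mul, ← map_mul, h1] at h2
  simpa [EAphi_apply] using h2

lemma exists_affAut_eq {A : GL2Z} {e : MulAut (EA A)} (he : e ∈ Aut₀ A) :
    ∃ x, affAut A x = e := by
  refine ⟨⟨(e (inr (ofAdd 1))).left, restrictAut he, restrictAut_mem he⟩, ?_⟩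
  have hr : (e (inr (ofAdd 1))).right = ofAdd 1 := by simpa using he.2 (inr (ofAdd 1))
  ext1 g
  rw [affAut_apply]
  refine DFunLike.congr_fun (f := affEnd A _) (g := e.toMonoidHom) (EA_hom_ext ?_ ?_) g
  · intro n
    simp
  · rw [affEnd_inr_one]
    ext1 <;> simp [hr]

/-- `Aut₀(E_A)` is the group of affine maps whose linear part commutes with `A`. -/
noncomputable def affCentralizerEquiv (A : GL2Z) : AffCentralizer A ≃* Aut₀ A :=
  MulEquiv.ofBijective ((affAut A).codRestrict (Aut₀ A) (affAut_mem A))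
    ⟨fun _ _ h => affAut_injective A (congrArg Subtype.val h),
      fun e => (exists_affAut_eq e.2).imp fun _ h => Subtype.ext h⟩

lemma mulVec2_injective : Function.Injective mulVec2 := by
  intro M N h
  have h1 := congrFun h (1, 0)
  have h2 := congrFun h (0, 1)
  simp only [mulVec2, Prod.mk.injEq, mul_one, mul_zero, add_zero, zero_add] at h1 h2
  ext i j
  fin_cases i <;> fin_cases j
  exacts [h1.1, h2.1, h1.2, h2.2]

/-- `glMulAut` as a group homomorphism. -/
def glMulAutHom : GL2Z →* MulAut (Multiplicative (ℤ × ℤ)) where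
  toFun := glMulAut
  map_one' := MulEquiv.ext fun p => congrArg ofAdd (mulVec2_one (toAdd p))
  map_mul' A B := MulEquiv.ext fun p => congrArg ofAdd (mulVec2_mul A B (toAdd p))

lemma glMulAutHom_apply (A : GL2Z) : glMulAutHom A = glMulAut A := rfl

lemma glMulAutHom_injective : Function.Injective glMulAutHom := by
  intro A B h
  apply Units.ext
  apply mulVec2_injective
  funext p
  exact congrArg toAdd (DFunLike.congr_fun h (ofAdd p))

/-- The matrix of an automorphism of `ℤ × ℤ`. -/
def matrixOfAut (c : MulAut (Multiplicative (ℤ × ℤ))) : Matrix (Fin 2) (Fin 2) ℤ :=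
  !![(toAdd (c (ofAdd (1, 0)))).1, (toAdd (c (ofAdd (0, 1)))).1;
    (toAdd (c (ofAdd (1, 0)))).2, (toAdd (c (ofAdd (0, 1)))).2]

lemma mulVec2_matrixOfAut (c : MulAut (Multiplicative (ℤ × ℤ))) (p : ℤ × ℤ) :
    mulVec2 (matrixOfAut c) p = toAdd (c (ofAdd p)) := by
  have hp : ofAdd p = ofAdd ((1, 0) : ℤ × ℤ) ^ p.1 * ofAdd ((0, 1) : ℤ × ℤ) ^ p.2 := by
    rw [← ofAdd_zsmul, ← ofAdd_zsmul, ← ofAdd_add]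
    simp
  rw [hp, map_mul, map_zpow, map_zpow]
  ext <;> simp [mulVec2, matrixOfAut] <;> ring

lemma matrixOfAut_mul_inv (c : MulAut (Multiplicative (ℤ × ℤ))) :
    matrixOfAut c * matrixOfAut c⁻¹ = 1 := by
  apply mulVec2_injective
  funext p
  rw [mulVec2_mul, mulVec2_matrixOfAut, mulVec2_matrixOfAut, mulVec2_one]
  simp

lemma glMulAutHom_surjective : Function.Surjective glMulAutHom := by
  intro c
  refine ⟨⟨matrixOfAut c, matrixOfAut c⁻¹, matrixOfAut_mul_inv c, ?_⟩, ?_⟩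
  · simpa using matrixOfAut_mul_inv c⁻¹
  · ext1 p
    exact congrArg ofAdd (mulVec2_matrixOfAut c (toAdd p))

lemma glMulAutHom_neg (B : GL2Z) :
    glMulAutHom (-B) = MulEquiv.inv (Multiplicative (ℤ × ℤ)) * glMulAutHom B := by
  ext1 p
  change ofAdd (mulVec2 (-(B : Matrix (Fin 2) (Fin 2) ℤ)) (toAdd p)) =
    ofAdd (-(mulVec2 (B : Matrix (Fin 2) (Fin 2) ℤ) (toAdd p)))
  congr 1
  ext <;> simp [mulVec2] <;> ring

lemma mem_autCentralizer_glMulAutHom {A B : GL2Z} :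
    glMulAutHom B ∈ autCentralizer A ↔ B * A * B⁻¹ = A := by
  rw [Subgroup.mem_centralizer_singleton_iff, ← glMulAutHom_apply, ← map_mul, ← map_mul,
    glMulAutHom_injective.eq_iff, mul_inv_eq_iff_eq_mul]

lemma trace_pow_strictMono {B : Matrix (Fin 2) (Fin 2) ℤ} (hd : B.det = 1) (ht : 3 ≤ B.trace)
    (n : ℕ) : 2 ≤ (B ^ n).trace ∧ (B ^ n).trace < (B ^ (n + 1)).trace := by
  induction n with
  | zero => simp; omega
  | succ n ih =>
    have hsq : B ^ 2 = B.trace • B - 1 := by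
      rw [Matrix.det_fin_two] at hd
      ext i j
      fin_cases i <;> fin_cases j <;>
        simp [pow_two, Matrix.mul_apply, Fin.sum_univ_two, Matrix.trace_fin_two,
          -zsmul_eq_mul]
      · linear_combination -hd
      · ring
      · ring
      · linear_combination -hd
    have hrec : (B ^ (n + 1 + 1)).trace = B.trace * (B ^ (n + 1)).trace - (B ^ n).trace := by
      rw [add_assoc, pow_add, hsq, mul_sub, mul_smul_comm, ← pow_succ, mul_one, Matrix.trace_sub,
        Matrix.trace_smul, smul_eq_mul]
    rw [hrec]
    constructor
    · omega
    · nlinarith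

lemma IsAnosov.not_isOfFinOrder {A : GL2Z} (hA : IsAnosov A) : ¬ IsOfFinOrder A := by
  intro hfin
  obtain ⟨n, hn, hpow⟩ := isOfFinOrder_iff_pow_eq_one.1 hfin
  set M : Matrix (Fin 2) (Fin 2) ℤ := A.val with hM
  have hdet : M.det = 1 ∨ M.det = -1 :=
    Int.isUnit_iff.1 ((Matrix.isUnit_iff_isUnit_det _).1 A.isUnit)
  have hd : (M ^ 2).det = 1 := by
    rw [Matrix.det_pow]
    rcases hdet with h | h <;> simp [h]
  have htr : (M ^ 2).trace = M.trace ^ 2 - 2 * M.det := by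
    simp [pow_two, Matrix.trace_fin_two, Matrix.mul_apply, Fin.sum_univ_two, Matrix.det_fin_two]
    ring
  have ht : 3 ≤ (M ^ 2).trace := by
    rw [htr]
    simp only [IsAnosov, IsExceptional, ← hM, not_or, not_and, not_le] at hA
    rcases hdet with h | h
    · have h3 : 3 ≤ |M.trace| := hA.1 h
      rw [h, ← sq_abs]
      nlinarith
    · have h0 := sq_pos_of_ne_zero (hA.2 h)
      rw [h]
      omega
  have hone : M ^ n = 1 := by
    rw [hM, ← Units.val_pow_eq_pow_val, hpow, Units.val_one]
  have hmono := strictMono_nat_of_lt_succ (fun k => (trace_pow_strictMono hd ht k).2) hn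
  have hsq : (M ^ 2) ^ n = 1 := by
    rw [← pow_mul, mul_comm, pow_mul, hone, one_pow]
  simp only [hsq, pow_zero, lt_irrefl] at hmono

lemma not_isOfFinOrder_primitiveRoot {A M₀ : GL2Z} (hA : IsAnosov A)
    (hC : ∀ B : GL2Z, B * A * B⁻¹ = A ↔ ∃ ℓ : ℤ, B = M₀ ^ ℓ ∨ B = -(M₀ ^ ℓ)) :
    ¬ IsOfFinOrder M₀ := by
  intro hfin
  obtain ⟨k, hk⟩ := (hC A).1 (by simp)
  have hsq : A ^ 2 = (M₀ ^ k) ^ 2 := by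
    rcases hk with h | h
    · rw [h]
    · rw [h, neg_sq]
  apply hA.not_isOfFinOrder
  have h2 : IsOfFinOrder (A ^ 2) := hsq ▸ hfin.zpow.pow
  exact h2.of_pow two_ne_zero

lemma eq_one_or_eq_ofAdd_one : ∀ ε : Multiplicative (ZMod 2), ε = 1 ∨ ε = ofAdd 1 := by
  decide

/-- The homomorphism `ℤ/2 → G` sending the generator to an involution `g`. -/
def involutionHom {G : Type*} [Group G] (g : G) (hg : g * g = 1) :
    Multiplicative (ZMod 2) →* G where
  toFun ε := if ε = 1 then 1 else g
  map_one' := if_pos rfl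
  map_mul' := by
    have hne : ofAdd (1 : ZMod 2) ≠ 1 := by decide
    have hmul : ofAdd (1 : ZMod 2) * ofAdd 1 = 1 := by decide
    intro ε δ
    rcases eq_one_or_eq_ofAdd_one ε with rfl | rfl <;>
      rcases eq_one_or_eq_ofAdd_one δ with rfl | rfl <;> simp [hne, hmul, hg]

@[simp]
lemma involutionHom_ofAdd_one {G : Type*} [Group G] (g : G) (hg : g * g = 1) :
    involutionHom g hg (ofAdd 1) = g :=
  if_neg (t := (1 : G)) (show ofAdd (1 : ZMod 2) ≠ 1 by decide)

/-- The automorphism `(m, n, t) ↦ (-m, -n, t)` of `E_M`. -/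
def flipAut (M : GL2Z) : MulAut (EA M) where
  toFun x := ⟨x.left⁻¹, x.right⟩
  invFun x := ⟨x.left⁻¹, x.right⟩
  left_inv x := by simp
  right_inv x := by simp
  map_mul' x y := by ext1 <;> simp [mul_comm]

@[simp]
lemma flipAut_left (M : GL2Z) (x : EA M) : (flipAut M x).left = x.left⁻¹ := rfl

@[simp]
lemma flipAut_right (M : GL2Z) (x : EA M) : (flipAut M x).right = x.right := rfl

lemma flipAut_mul_self (M : GL2Z) : flipAut M * flipAut M = 1 := by
  ext1 x
  ext1 <;> simp

/-- The action of `ℤ/2` on `E_M` through `flipAut`. -/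
def flipHom (M : GL2Z) : Multiplicative (ZMod 2) →* MulAut (EA M) :=
  involutionHom (flipAut M) (flipAut_mul_self M)

/-- Inversion of `ℤ × ℤ`, as an element of the centralizer of `A`. -/
def invCentralizer (A : GL2Z) : autCentralizer A :=
  ⟨MulEquiv.inv (Multiplicative (ℤ × ℤ)), by
    rw [Subgroup.mem_centralizer_singleton_iff]
    ext1 p
    simp⟩

lemma invCentralizer_mul_self (A : GL2Z) : invCentralizer A * invCentralizer A = 1 := by
  ext1
  ext1 p
  simp [invCentralizer]

/-- The homomorphism from the iterated semidirect product to the affine group, sending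
`(v, ℓ, ε)` to the affine map with translation part `v` and linear part `± M₀ ^ ℓ`. -/
def iteratedToAff {A M₀ : GL2Z} (hM : glMulAut M₀ ∈ autCentralizer A) :
    EA M₀ ⋊[flipHom M₀] Multiplicative (ZMod 2) →* AffCentralizer A :=
  SemidirectProduct.lift
    (SemidirectProduct.map (MonoidHom.id _) (zpowersHom (autCentralizer A) ⟨glMulAut M₀, hM⟩)
      (fun t => by
        refine MonoidHom.ext fun n => ?_
        simp [EAphi_apply]))
    (inr.comp (involutionHom (invCentralizer A) (invCentralizer_mul_self A))) <| by
    intro ε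
    refine MonoidHom.ext fun x => ?_
    rcases eq_one_or_eq_ofAdd_one ε with rfl | rfl
    · simp
    · have hcomm : Commute (invCentralizer A)
          ((⟨glMulAut M₀, hM⟩ : autCentralizer A) ^ toAdd x.right) := by
        apply Commute.zpow_right
        ext1
        ext1 p
        simp [invCentralizer]
      ext1
      · simp [flipHom, invCentralizer]
      · simp [flipHom, hcomm.eq]

lemma iteratedToAff_left {A M₀ : GL2Z} (hM : glMulAut M₀ ∈ autCentralizer A)
    (x : EA M₀ ⋊[flipHom M₀] Multiplicative (ZMod 2)) :
    (iteratedToAff hM x).left = x.left.left := by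
  simp [iteratedToAff, SemidirectProduct.lift]

lemma iteratedToAff_right {A M₀ : GL2Z} (hM : glMulAut M₀ ∈ autCentralizer A)
    (x : EA M₀ ⋊[flipHom M₀] Multiplicative (ZMod 2)) :
    (iteratedToAff hM x).right = ⟨glMulAut M₀, hM⟩ ^ toAdd x.left.right *
      involutionHom (invCentralizer A) (invCentralizer_mul_self A) x.right := by
  simp [iteratedToAff, SemidirectProduct.lift]

lemma involutionHom_invCentralizer (A : GL2Z) (ε : Multiplicative (ZMod 2)) :
    (involutionHom (invCentralizer A) (invCentralizer_mul_self A) ε : MulAut _) =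
      glMulAutHom (involutionHom (-1 : GL2Z) (by simp) ε) := by
  rcases eq_one_or_eq_ofAdd_one ε with rfl | rfl
  · simp
  · rw [involutionHom_ofAdd_one, involutionHom_ofAdd_one, glMulAutHom_neg]
    simp [invCentralizer]

lemma iteratedToAff_right_coe {A M₀ : GL2Z} (hM : glMulAut M₀ ∈ autCentralizer A)
    (x : EA M₀ ⋊[flipHom M₀] Multiplicative (ZMod 2)) :
    ((iteratedToAff hM x).right : MulAut _) =
      glMulAutHom (M₀ ^ toAdd x.left.right * involutionHom (-1 : GL2Z) (by simp) x.right) := by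
  rw [iteratedToAff_right, Subgroup.coe_mul, involutionHom_invCentralizer, map_mul, map_zpow,
    glMulAutHom_apply M₀, SubgroupClass.coe_zpow]

lemma involutionHom_neg_one_injective :
    Function.Injective (involutionHom (-1 : GL2Z) (by simp)) := by
  have hne : (-1 : GL2Z) ≠ 1 := by
    intro h
    have := congrArg (fun B : GL2Z => (B : Matrix (Fin 2) (Fin 2) ℤ) 0 0) h
    simp at this
  rw [injective_iff_map_eq_one]
  intro ε hε
  rcases eq_one_or_eq_ofAdd_one ε with rfl | rfl
  · rfl
  · exact absurd (by simpa using hε) hne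

lemma iteratedToAff_injective {A M₀ : GL2Z} (hM : glMulAut M₀ ∈ autCentralizer A)
    (hfin : ¬ IsOfFinOrder M₀) : Function.Injective (iteratedToAff hM) := by
  intro x y hxy
  have hl := congrArg SemidirectProduct.left hxy
  rw [iteratedToAff_left, iteratedToAff_left] at hl
  have hr := congrArg (fun z => (z.right : MulAut (Multiplicative (ℤ × ℤ)))) hxy
  simp only [iteratedToAff_right_coe, glMulAutHom_injective.eq_iff] at hr
  have hinj := injective_zpow_iff_not_isOfFinOrder.2 hfin
  have ht : x.left.right = y.left.right := by
    have hsq : ∀ (k : ℤ) (ε : Multiplicative (ZMod 2)),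
        (M₀ ^ k * involutionHom (-1 : GL2Z) (by simp) ε) ^ 2 = M₀ ^ (k * 2) := by
      intro k ε
      rcases eq_one_or_eq_ofAdd_one ε with rfl | rfl <;>
        simp [_root_.zpow_mul, zpow_ofNat]
    have h2 := hinj ((hsq _ _).symm.trans ((congrArg (· ^ 2) hr).trans (hsq _ _)))
    exact toAdd.injective (by omega)
  rw [ht, mul_right_inj, involutionHom_neg_one_injective.eq_iff] at hr
  exact SemidirectProduct.ext (SemidirectProduct.ext hl ht) hr

lemma iteratedToAff_surjective {A M₀ : GL2Z} (hM : glMulAut M₀ ∈ autCentralizer A)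
    (hC : ∀ B : GL2Z, B * A * B⁻¹ = A → ∃ ℓ : ℤ, B = M₀ ^ ℓ ∨ B = -(M₀ ^ ℓ)) :
    Function.Surjective (iteratedToAff hM) := by
  rintro ⟨v, c, hc⟩
  obtain ⟨B, rfl⟩ := glMulAutHom_surjective c
  obtain ⟨ℓ, hℓ⟩ := hC B (mem_autCentralizer_glMulAutHom.1 hc)
  obtain ⟨ε, hε⟩ : ∃ ε, B = M₀ ^ ℓ * involutionHom (-1 : GL2Z) (by simp) ε := by
    rcases hℓ with h | h
    · exact ⟨1, by simp [h]⟩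
    · exact ⟨ofAdd 1, by simp [h]⟩
  refine ⟨⟨⟨v, ofAdd ℓ⟩, ε⟩, SemidirectProduct.ext ?_ (Subtype.ext ?_)⟩
  · rw [iteratedToAff_left]
  · exact (iteratedToAff_right_coe hM _).trans (congrArg glMulAutHom hε.symm)

/-- If `A` is Anosov and `M₀` is a primitive root of `A`
(`C(A) = {± M₀ ^ ℓ}`), then `Aut₀(E_A) ≅ ((ℤ × ℤ) ⋊[M₀] ℤ) ⋊ ℤ/2`, where the nontrivial element
of `ℤ/2` acts on `(ℤ × ℤ) ⋊ ℤ = E_{M₀}` by `(m, n, t) ↦ (-m, -n, t)`. -/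
theorem stmt1 (A M₀ : GL2Z) (hA : IsAnosov A)
    (hC : ∀ B : GL2Z, B * A * B⁻¹ = A ↔ ∃ ℓ : ℤ, B = M₀ ^ ℓ ∨ B = -(M₀ ^ ℓ)) :
    ∃ ψ : Multiplicative (ZMod 2) →* MulAut (EA M₀),
      (∀ x : EA M₀, (ψ (Multiplicative.ofAdd 1) x).left = (x.left)⁻¹ ∧
        (ψ (Multiplicative.ofAdd 1) x).right = x.right) ∧
      Nonempty ((Aut₀ A) ≃* (EA M₀ ⋊[ψ] Multiplicative (ZMod 2))) := by
  have hM : glMulAut M₀ ∈ autCentralizer A :=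
    mem_autCentralizer_glMulAutHom.2 ((hC M₀).2 ⟨1, Or.inl (zpow_one M₀).symm⟩)
  refine ⟨flipHom M₀, fun x => by simp [flipHom], ⟨(affCentralizerEquiv A).symm.trans ?_⟩⟩
  exact (MulEquiv.ofBijective (iteratedToAff hM)
    ⟨iteratedToAff_injective hM (not_isOfFinOrder_primitiveRoot hA hC),
      iteratedToAff_surjective hM fun B => (hC B).1⟩).symm
end

section
/- Let A ∈ GL(2,ℤ) be an Anosov matrix. Then R(A) ≠ ∅ if and only if det A = 1 and A is conjugate in GL(2,ℤ) to a matrix of one of the following three forms: [[x, y], [z, x]] (equal diagonal entries), [[x, y], [y, z]] (symmetric), or [[x, y], [w−x, w]]. Moreover, if A is conjugate to a matrix of the first or third form then there exists B₀ ∈ R(A) with B₀² = I, and if A is conjugate to a matrix of the second form then there exists B₀ ∈ R(A) with B₀² = −I. -/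
open Matrix SemidirectProduct Multiplicative

lemma exists_two_mul_abs_add_mul_le (p : ℤ) {r : ℤ} (hr : r ≠ 0) :
    ∃ n : ℤ, 2 * |p + n * r| ≤ |r| := by
  have hmod := Int.emod_add_mul_ediv p r
  have h0 := Int.emod_nonneg p hr
  have h1 := Int.emod_lt_abs p hr
  by_cases h : 2 * (p % r) ≤ |r|
  · refine ⟨-(p / r), ?_⟩
    rw [show p + -(p / r) * r = p % r by linarith, abs_of_nonneg h0]
    exact h
  · refine ⟨-(p / r) - r.sign, ?_⟩
    rw [show p + (-(p / r) - r.sign) * r = p % r - |r| by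
      have := Int.sign_mul_self_eq_abs r
      linarith, abs_of_neg (by linarith)]
    linarith

/-- Representatives, up to sign and conjugation, of the traceless matrices in `GL(2,ℤ)`. -/
def tracelessNormalForms : Set (Matrix (Fin 2) (Fin 2) ℤ) :=
  {!![1, 0; 0, -1], !![1, 1; 0, -1], !![0, 1; -1, 0]}

/-- `B` is conjugate, up to sign, to one of the normal forms. -/
def HasTracelessNormalForm (B : Matrix (Fin 2) (Fin 2) ℤ) : Prop :=
  ∃ P : Matrix (Fin 2) (Fin 2) ℤ, IsUnit P.det ∧ ∃ ε : ℤ, ε * ε = 1 ∧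
    ∃ N ∈ tracelessNormalForms, P * B = (ε • N) * P

lemma HasTracelessNormalForm.of_conj {B C Q : Matrix (Fin 2) (Fin 2) ℤ} (hQ : IsUnit Q.det)
    (h : Q * B = C * Q) (hC : HasTracelessNormalForm C) : HasTracelessNormalForm B := by
  obtain ⟨P, hP, ε, hε, N, hN, hPN⟩ := hC
  refine ⟨P * Q, by rw [det_mul]; exact hP.mul hQ, ε, hε, N, hN, ?_⟩
  rw [Matrix.mul_assoc, h, ← Matrix.mul_assoc, hPN, Matrix.mul_assoc]

lemma hasTracelessNormalForm_upper {p : ℤ} (q : ℤ) (hp : p * p = 1) :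
    HasTracelessNormalForm !![p, q; 0, -p] := by
  obtain ⟨k, hk | hk⟩ := Int.even_or_odd' (p * q)
  · refine ⟨!![1, k; 0, 1], by simp [det_fin_two], p, hp, _, Or.inl rfl, ?_⟩
    have : q = 2 * k * p := by linear_combination p * hk - q * hp
    ext i j; fin_cases i <;> fin_cases j <;> simp [Matrix.mul_apply, Fin.sum_univ_two, this]
    ring
  · refine ⟨!![1, k; 0, 1], by simp [det_fin_two], p, hp, _, Or.inr (Or.inl rfl), ?_⟩
    have : q = (2 * k + 1) * p := by linear_combination p * hk - q * hp
    ext i j; fin_cases i <;> fin_cases j <;> simp [Matrix.mul_apply, Fin.sum_univ_two, this]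
    ring

lemma hasTracelessNormalForm_antidiagonal {q r : ℤ} (hr : r * r = 1) (hq : q * r = 1 ∨ q * r = -1) :
    HasTracelessNormalForm !![0, q; r, 0] := by
  obtain hq | hq := hq
  · have : q = r := by linear_combination r * hq - q * hr
    refine ⟨!![0, 1; -1, -1], by simp [det_fin_two], -r, by linarith, _, Or.inr (Or.inl rfl), ?_⟩
    ext i j; fin_cases i <;> fin_cases j <;> simp [Matrix.mul_apply, Fin.sum_univ_two, this]
  · have : q = -r := by linear_combination r * hq - q * hr
    refine ⟨1, by simp, -r, by linarith, _, Or.inr (Or.inr rfl), ?_⟩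
    ext i j; fin_cases i <;> fin_cases j <;> simp [this]

lemma hasTracelessNormalForm_of_sq_add_mul (p q r : ℤ)
    (h : p ^ 2 + q * r = 1 ∨ p ^ 2 + q * r = -1) :
    HasTracelessNormalForm !![p, q; r, -p] := by
  induction hn : r.natAbs using Nat.strong_induction_on generalizing p q r with
  | _ m ih =>
  by_cases hr : r = 0
  · subst hr
    exact hasTracelessNormalForm_upper q (by rcases h with h | h <;> nlinarith)
  obtain ⟨n, hpn⟩ := exists_two_mul_abs_add_mul_le p hr
  set p' := p + n * r with hp'
  set q' := q - 2 * n * p - n ^ 2 * r with hq'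
  have hinv : p' ^ 2 + q' * r = p ^ 2 + q * r := by rw [hp', hq']; ring
  rw [← hinv] at h
  refine HasTracelessNormalForm.of_conj (Q := !![1, n; 0, 1]) (C := !![p', q'; r, -p'])
    (by simp [det_fin_two]) ?_ ?_
  · ext i j; fin_cases i <;> fin_cases j <;>
      simp [Matrix.mul_apply, Fin.sum_univ_two, hp', hq'] <;> ring
  have hr1 : 1 ≤ |r| := Int.one_le_abs hr
  by_cases hr2 : |r| = 1
  · have hp0 : p' = 0 := by
      rw [← abs_eq_zero]
      have := abs_nonneg p'
      lia
    rw [hp0] at h ⊢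
    rw [neg_zero]
    exact hasTracelessNormalForm_antidiagonal (by rw [← abs_mul_abs_self, hr2, one_mul])
      (by simpa using h)
  · refine HasTracelessNormalForm.of_conj (Q := !![0, 1; 1, 0]) (C := !![-p', r; q', - -p'])
      (by simp [det_fin_two]) ?_ (ih q'.natAbs ?_ _ _ _ ?_ rfl)
    · ext i j; fin_cases i <;> fin_cases j <;> simp [Matrix.mul_apply, Fin.sum_univ_two]
    · rw [← hn]
      zify
      have hqr : |q'| * |r| ≤ 1 + |p'| ^ 2 := by
        rw [← abs_mul, sq_abs, abs_le]
        constructor <;> rcases h with h | h <;> nlinarith [sq_nonneg p']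
      by_contra! hlt
      have := abs_nonneg p'
      have : 2 ≤ |r| := by lia
      nlinarith
    · rcases h with h | h
      · left; linarith
      · right; linarith

lemma coe_inv_of_det_eq_one {M : GL2Z} (h : (M : Matrix (Fin 2) (Fin 2) ℤ).det = 1) :
    ((M⁻¹ : GL2Z) : Matrix (Fin 2) (Fin 2) ℤ) = !![M 1 1, -M 0 1; -M 1 0, M 0 0] := by
  rw [Matrix.coe_units_inv, Matrix.inv_def, h, Ring.inverse_one, one_smul, adjugate_fin_two]

lemma det_coe_conj (P A : GL2Z) :
    ((P * A * P⁻¹ : GL2Z) : Matrix (Fin 2) (Fin 2) ℤ).det =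
      (A : Matrix (Fin 2) (Fin 2) ℤ).det := by
  rw [Units.val_mul, Units.val_mul, det_units_conj]

lemma conj_eq_inv_iff_coe {A B : GL2Z} (hdet : (A : Matrix (Fin 2) (Fin 2) ℤ).det = 1) :
    B * A * B⁻¹ = A⁻¹ ↔ (B : Matrix (Fin 2) (Fin 2) ℤ) * A =
      !![A 1 1, -A 0 1; -A 1 0, A 0 0] * (B : Matrix (Fin 2) (Fin 2) ℤ) := by
  rw [mul_inv_eq_iff_eq_mul, Units.ext_iff, Units.val_mul, Units.val_mul,
    coe_inv_of_det_eq_one hdet]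

/-- A reversor of a conjugate of `A` yields a reversor of `A` with the same square. -/
lemma exists_reversor_of_conj {A P C ε : GL2Z} (hC : C * (P * A * P⁻¹) * C⁻¹ = (P * A * P⁻¹)⁻¹)
    (hsq : C ^ 2 = ε) (hε : P⁻¹ * ε * P = ε) : ∃ B : GL2Z, B * A * B⁻¹ = A⁻¹ ∧ B ^ 2 = ε := by
  refine ⟨P⁻¹ * C * P, ?_, ?_⟩
  · calc P⁻¹ * C * P * A * (P⁻¹ * C * P)⁻¹ = P⁻¹ * (C * (P * A * P⁻¹) * C⁻¹) * P := by group
      _ = A⁻¹ := by rw [hC]; group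
  · calc (P⁻¹ * C * P) ^ 2 = P⁻¹ * C ^ 2 * P := by rw [pow_two, pow_two]; group
      _ = ε := by rw [hsq, hε]

lemma exists_involution_of_diag_eq {A P : GL2Z} (hdet : (A : Matrix (Fin 2) (Fin 2) ℤ).det = 1)
    (h : (P * A * P⁻¹ : GL2Z) 0 0 = (P * A * P⁻¹ : GL2Z) 1 1) :
    ∃ B : GL2Z, B * A * B⁻¹ = A⁻¹ ∧ B ^ 2 = 1 := by
  have hsq : (!![1, 0; 0, -1] : Matrix (Fin 2) (Fin 2) ℤ) * !![1, 0; 0, -1] = 1 := by decide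
  refine exists_reversor_of_conj (P := P) (C := ⟨_, _, hsq, hsq⟩)
    ((conj_eq_inv_iff_coe (by rw [det_coe_conj, hdet])).2 ?_)
    (Units.ext (by rw [pow_two]; exact hsq)) (by group)
  generalize P * A * P⁻¹ = M at *
  ext i j; fin_cases i <;> fin_cases j <;> simp [Matrix.mul_apply, Fin.sum_univ_two, h]

lemma exists_involution_of_apply_one_zero_eq_sub {A P : GL2Z}
    (hdet : (A : Matrix (Fin 2) (Fin 2) ℤ).det = 1)
    (h : (P * A * P⁻¹ : GL2Z) 1 0 = (P * A * P⁻¹ : GL2Z) 1 1 - (P * A * P⁻¹ : GL2Z) 0 0) :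
    ∃ B : GL2Z, B * A * B⁻¹ = A⁻¹ ∧ B ^ 2 = 1 := by
  have hsq : (!![1, 1; 0, -1] : Matrix (Fin 2) (Fin 2) ℤ) * !![1, 1; 0, -1] = 1 := by decide
  refine exists_reversor_of_conj (P := P) (C := ⟨_, _, hsq, hsq⟩)
    ((conj_eq_inv_iff_coe (by rw [det_coe_conj, hdet])).2 ?_)
    (Units.ext (by rw [pow_two]; exact hsq)) (by group)
  generalize P * A * P⁻¹ = M at *
  ext i j; fin_cases i <;> fin_cases j <;> simp [Matrix.mul_apply, Fin.sum_univ_two, h] <;> ring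

lemma exists_sq_eq_neg_one_of_symm {A P : GL2Z} (hdet : (A : Matrix (Fin 2) (Fin 2) ℤ).det = 1)
    (h : (P * A * P⁻¹ : GL2Z) 0 1 = (P * A * P⁻¹ : GL2Z) 1 0) :
    ∃ B : GL2Z, B * A * B⁻¹ = A⁻¹ ∧ B ^ 2 = -1 := by
  have hl : (!![0, 1; -1, 0] : Matrix (Fin 2) (Fin 2) ℤ) * !![0, -1; 1, 0] = 1 := by decide
  have hr : (!![0, -1; 1, 0] : Matrix (Fin 2) (Fin 2) ℤ) * !![0, 1; -1, 0] = 1 := by decide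
  have hsq : (!![0, 1; -1, 0] : Matrix (Fin 2) (Fin 2) ℤ) * !![0, 1; -1, 0] = -1 := by decide
  refine exists_reversor_of_conj (P := P) (C := ⟨_, _, hl, hr⟩)
    ((conj_eq_inv_iff_coe (by rw [det_coe_conj, hdet])).2 ?_)
    (Units.ext (by rw [pow_two]; exact hsq)) (by simp)
  generalize P * A * P⁻¹ = M at *
  ext i j; fin_cases i <;> fin_cases j <;> simp [Matrix.mul_apply, Fin.sum_univ_two, h]

lemma IsAnosov.det_eq_one_of_conj_eq_inv {A B : GL2Z} (hA : IsAnosov A)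
    (hB : B * A * B⁻¹ = A⁻¹) : (A : Matrix (Fin 2) (Fin 2) ℤ).det = 1 := by
  have hunit : IsUnit (A : Matrix (Fin 2) (Fin 2) ℤ).det := (isUnit_iff_isUnit_det _).1 A.isUnit
  refine (Int.isUnit_iff.1 hunit).resolve_right fun h => hA (Or.inr ⟨h, ?_⟩)
  have htr := congrArg (fun M : GL2Z => (M : Matrix (Fin 2) (Fin 2) ℤ).trace) hB
  have hinv : Ring.inverse (-1 : ℤ) = -1 := by
    simpa using Ring.inverse_unit (-1 : ℤˣ)
  simp only [Units.val_mul, trace_units_conj] at htr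
  rw [Matrix.coe_units_inv, Matrix.inv_def, h, hinv, adjugate_fin_two] at htr
  simp [trace_fin_two] at htr ⊢
  linarith

/-- A reversor of an Anosov matrix is traceless. -/
lemma IsAnosov.trace_eq_zero_of_conj_eq_inv {A B : GL2Z} (hA : IsAnosov A)
    (hB : B * A * B⁻¹ = A⁻¹) : B 0 0 + B 1 1 = 0 := by
  have hdet := hA.det_eq_one_of_conj_eq_inv hB
  have hmul := (conj_eq_inv_iff_coe hdet).1 hB
  by_contra hs
  have h00 := congrFun (congrFun hmul 0) 0
  have h01 := congrFun (congrFun hmul 0) 1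
  have h10 := congrFun (congrFun hmul 1) 0
  have h11 := congrFun (congrFun hmul 1) 1
  simp [Matrix.mul_apply, Fin.sum_univ_two] at h00 h01 h10 h11
  have hb : A 0 1 = 0 :=
    (mul_eq_zero.1 (by linarith : A 0 1 * (B 0 0 + B 1 1) = 0)).resolve_right hs
  have hd : A 0 0 - A 1 1 = 0 :=
    (mul_eq_zero.1 (by linarith : (A 0 0 - A 1 1) * (B 0 0 + B 1 1) = 0)).resolve_right hs
  refine hA (Or.inl ⟨hdet, ?_⟩)
  rw [det_fin_two, hb, zero_mul, sub_zero, sub_eq_zero.1 hd] at hdet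
  rw [trace_fin_two, sub_eq_zero.1 hd]
  rcases mul_self_eq_one_iff.1 hdet with h | h <;> simp [h]

lemma IsAnosov.exists_conj_of_conj_eq_inv {A B : GL2Z} (hA : IsAnosov A)
    (hB : B * A * B⁻¹ = A⁻¹) :
    (∃ P : GL2Z, (P * A * P⁻¹ : GL2Z) 0 0 = (P * A * P⁻¹ : GL2Z) 1 1) ∨
    (∃ P : GL2Z, (P * A * P⁻¹ : GL2Z) 0 1 = (P * A * P⁻¹ : GL2Z) 1 0) ∨
    (∃ P : GL2Z, (P * A * P⁻¹ : GL2Z) 1 0 =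
      (P * A * P⁻¹ : GL2Z) 1 1 - (P * A * P⁻¹ : GL2Z) 0 0) := by
  have hdet := hA.det_eq_one_of_conj_eq_inv hB
  have htr : B 1 1 = -B 0 0 := by linarith [hA.trace_eq_zero_of_conj_eq_inv hB]
  have hBdet := Int.isUnit_iff.1
    ((isUnit_iff_isUnit_det (B : Matrix (Fin 2) (Fin 2) ℤ)).1 B.isUnit)
  rw [det_fin_two, htr] at hBdet
  have hnf := hasTracelessNormalForm_of_sq_add_mul (B 0 0) (B 0 1) (B 1 0)
    (by rcases hBdet with h | h
        · right; linarith
        · left; linarith)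
  rw [← htr, ← eta_fin_two] at hnf
  obtain ⟨Q, hQ, ε, hε, N, hN, hQN⟩ := hnf
  obtain ⟨P, rfl⟩ := (isUnit_iff_isUnit_det Q).2 hQ
  have hconj : P * B * P⁻¹ * (P * A * P⁻¹) * (P * B * P⁻¹)⁻¹ = (P * A * P⁻¹)⁻¹ := by
    calc _ = P * (B * A * B⁻¹) * P⁻¹ := by group
      _ = _ := by rw [hB]; group
  have hcoe : ((P * B * P⁻¹ : GL2Z) : Matrix (Fin 2) (Fin 2) ℤ) = ε • N := by
    rw [Units.val_mul, Units.val_mul, hQN, Matrix.mul_assoc, Units.mul_inv, Matrix.mul_one]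
  have hmul := (conj_eq_inv_iff_coe (by rw [det_coe_conj, hdet])).1 hconj
  rw [hcoe, Matrix.smul_mul, Matrix.mul_smul] at hmul
  have hε0 : ε ≠ 0 := by rintro rfl; simp at hε
  replace hmul := smul_right_injective _ hε0 hmul
  rcases hN with rfl | rfl | rfl
  · refine Or.inl ⟨P, ?_⟩
    have h00 := congrFun (congrFun hmul 0) 0
    generalize P * A * P⁻¹ = M at *
    simpa [Matrix.mul_apply, Fin.sum_univ_two] using h00
  · refine Or.inr (Or.inr ⟨P, ?_⟩)
    have h00 := congrFun (congrFun hmul 0) 0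
    generalize P * A * P⁻¹ = M at *
    simp [Matrix.mul_apply, Fin.sum_univ_two] at h00
    linarith
  · refine Or.inr (Or.inl ⟨P, ?_⟩)
    have h00 := congrFun (congrFun hmul 0) 0
    generalize P * A * P⁻¹ = M at *
    simp [Matrix.mul_apply, Fin.sum_univ_two] at h00
    linarith

/-- For `A` Anosov, `R(A) ≠ ∅` iff `det A = 1` and `A` is conjugate in
`GL(2,ℤ)` to a matrix with equal diagonal entries, or to a symmetric matrix, or to a matrix
`[[x, y], [w - x, w]]`; moreover in the first and third cases some `B₀ ∈ R(A)` satisfies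
`B₀² = I`, and in the second case some `B₀ ∈ R(A)` satisfies `B₀² = -I`. -/
theorem stmt3 (A : GL2Z) (hA : IsAnosov A) :
    ({B : GL2Z | B * A * B⁻¹ = A⁻¹}.Nonempty ↔
      ((A : Matrix (Fin 2) (Fin 2) ℤ).det = 1 ∧
        ((∃ P : GL2Z, ((P * A * P⁻¹ : GL2Z) : Matrix (Fin 2) (Fin 2) ℤ) 0 0 =
            ((P * A * P⁻¹ : GL2Z) : Matrix (Fin 2) (Fin 2) ℤ) 1 1) ∨
         (∃ P : GL2Z, ((P * A * P⁻¹ : GL2Z) : Matrix (Fin 2) (Fin 2) ℤ) 0 1 =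
            ((P * A * P⁻¹ : GL2Z) : Matrix (Fin 2) (Fin 2) ℤ) 1 0) ∨
         (∃ P : GL2Z, ((P * A * P⁻¹ : GL2Z) : Matrix (Fin 2) (Fin 2) ℤ) 1 0 =
            ((P * A * P⁻¹ : GL2Z) : Matrix (Fin 2) (Fin 2) ℤ) 1 1 -
              ((P * A * P⁻¹ : GL2Z) : Matrix (Fin 2) (Fin 2) ℤ) 0 0)))) ∧
    (((A : Matrix (Fin 2) (Fin 2) ℤ).det = 1 ∧
        ((∃ P : GL2Z, ((P * A * P⁻¹ : GL2Z) : Matrix (Fin 2) (Fin 2) ℤ) 0 0 =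
            ((P * A * P⁻¹ : GL2Z) : Matrix (Fin 2) (Fin 2) ℤ) 1 1) ∨
         (∃ P : GL2Z, ((P * A * P⁻¹ : GL2Z) : Matrix (Fin 2) (Fin 2) ℤ) 1 0 =
            ((P * A * P⁻¹ : GL2Z) : Matrix (Fin 2) (Fin 2) ℤ) 1 1 -
              ((P * A * P⁻¹ : GL2Z) : Matrix (Fin 2) (Fin 2) ℤ) 0 0))) →
      ∃ B₀ : GL2Z, B₀ * A * B₀⁻¹ = A⁻¹ ∧ B₀ ^ 2 = 1) ∧
    (((A : Matrix (Fin 2) (Fin 2) ℤ).det = 1 ∧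
        (∃ P : GL2Z, ((P * A * P⁻¹ : GL2Z) : Matrix (Fin 2) (Fin 2) ℤ) 0 1 =
            ((P * A * P⁻¹ : GL2Z) : Matrix (Fin 2) (Fin 2) ℤ) 1 0)) →
      ∃ B₀ : GL2Z, B₀ * A * B₀⁻¹ = A⁻¹ ∧ B₀ ^ 2 = -1) := by
  have hinvol : ((A : Matrix (Fin 2) (Fin 2) ℤ).det = 1 ∧
      ((∃ P : GL2Z, (P * A * P⁻¹ : GL2Z) 0 0 = (P * A * P⁻¹ : GL2Z) 1 1) ∨
       (∃ P : GL2Z, (P * A * P⁻¹ : GL2Z) 1 0 =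
          (P * A * P⁻¹ : GL2Z) 1 1 - (P * A * P⁻¹ : GL2Z) 0 0))) →
      ∃ B₀ : GL2Z, B₀ * A * B₀⁻¹ = A⁻¹ ∧ B₀ ^ 2 = 1 := by
    rintro ⟨hdet, ⟨P, h⟩ | ⟨P, h⟩⟩
    · exact exists_involution_of_diag_eq hdet h
    · exact exists_involution_of_apply_one_zero_eq_sub hdet h
  refine ⟨⟨?_, ?_⟩, hinvol, fun ⟨hdet, P, h⟩ => exists_sq_eq_neg_one_of_symm hdet h⟩
  · rintro ⟨B, hB⟩
    exact ⟨hA.det_eq_one_of_conj_eq_inv hB, hA.exists_conj_of_conj_eq_inv hB⟩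
  · rintro ⟨hdet, h | ⟨P, h⟩ | h⟩
    · obtain ⟨B, hB, -⟩ := hinvol ⟨hdet, Or.inl h⟩
      exact ⟨B, hB⟩
    · obtain ⟨B, hB, -⟩ := exists_sq_eq_neg_one_of_symm hdet h
      exact ⟨B, hB⟩
    · obtain ⟨B, hB, -⟩ := hinvol ⟨hdet, Or.inr h⟩
      exact ⟨B, hB⟩
end

section
/- Let A ∈ GL(2,ℤ) be an Anosov matrix. Then the outer automorphism group Out(E_A) = Aut(E_A)/Inn(E_A) is a finite group. -/
open Matrix SemidirectProduct Multiplicative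

/-- The inner automorphisms form a normal subgroup of `Aut(G)`. -/
instance innConjNormal (G : Type*) [Group G] :
    ((MulAut.conj : G →* MulAut G).range).Normal := by
  constructor
  intro x hx φ
  obtain ⟨g, rfl⟩ := hx
  refine ⟨φ g, ?_⟩
  ext h
  simp [MulAut.conj, mul_assoc]

/-- The outer automorphism group `Out(G) = Aut(G)/Inn(G)`. -/
abbrev OutG (G : Type*) [Group G] : Type _ :=
  MulAut G ⧸ (MulAut.conj : G →* MulAut G).range

namespace EA

/-- The element of `E_A` given by a vector of `ℤ × ℤ`. -/
def vec (A : GL2Z) (h : ℤ × ℤ) : EA A := inl (ofAdd h)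

/-- The stable letter of `E_A`. -/
def stable (A : GL2Z) : EA A := inr (ofAdd 1)

variable {A : GL2Z}

lemma vec_add (h k : ℤ × ℤ) : vec A (h + k) = vec A h * vec A k := by
  simp [vec, ofAdd_add]

lemma vec_neg (h : ℤ × ℤ) : vec A (-h) = (vec A h)⁻¹ := by
  simp [vec, ofAdd_neg]

lemma vec_injective : Function.Injective (vec A) := fun _ _ h =>
  ofAdd.injective (inl_injective h)

lemma stable_right : (stable A).right = ofAdd 1 := rfl

lemma eq_vec_of_right_eq_one {x : EA A} (hx : x.right = 1) : x = vec A (toAdd x.left) := by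
  ext <;> simp [vec, hx]

lemma stable_mul_vec (h : ℤ × ℤ) :
    stable A * vec A h = vec A (mulVec2 (A : Matrix (Fin 2) (Fin 2) ℤ) h) * stable A := by
  ext1
  · simp only [vec, stable, mul_left, left_inl, left_inr, right_inl, right_inr, map_one, one_mul,
      mul_one]
    simp [EAphi, zpowersHom_apply]
    rfl
  · simp [vec, stable]

lemma eq_vec_mul_stable_zpow (x : EA A) :
    x = vec A (toAdd x.left) * stable A ^ (toAdd x.right) := by
  have : stable A ^ (toAdd x.right) = inr x.right := by
    rw [stable, ← map_zpow, ← ofAdd_zsmul]; simp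
  rw [this]
  exact (inl_left_mul_inr_right x).symm

/-- The automorphism `φ` restricts to the matrix `M` on `ℤ × ℤ`. -/
def RestrictsTo (φ : MulAut (EA A)) (M : Matrix (Fin 2) (Fin 2) ℤ) : Prop :=
  ∀ h, φ (vec A h) = vec A (mulVec2 M h)

lemma RestrictsTo.mul {φ ψ : MulAut (EA A)} {M N : Matrix (Fin 2) (Fin 2) ℤ}
    (hφ : RestrictsTo φ M) (hψ : RestrictsTo ψ N) : RestrictsTo (φ * ψ) (M * N) := fun h => by
  rw [MulAut.mul_apply, hψ, hφ, mulVec2_mul]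

/-- The pairs of an automorphism of `E_A` and its restriction to `ℤ × ℤ`. -/
def restrictionSubgroup (A : GL2Z) : Subgroup (MulAut (EA A) × GL2Z) where
  carrier := {x | RestrictsTo x.1 (x.2 : Matrix (Fin 2) (Fin 2) ℤ)}
  mul_mem' hx hy := hx.mul hy
  one_mem' h := by simp [mulVec2_one]
  inv_mem' := by
    rintro ⟨φ, B⟩ hφ h
    change φ⁻¹ (vec A h) = _
    rw [MulAut.inv_apply, MulEquiv.symm_apply_eq, hφ, ← mulVec2_mul]
    simp only [Prod.snd_inv]
    rw [show (B : Matrix (Fin 2) (Fin 2) ℤ) * ((B⁻¹ : GL2Z) : Matrix (Fin 2) (Fin 2) ℤ) = 1 from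
      B.mul_inv, mulVec2_one]

lemma restrictsTo_conj_stable :
    RestrictsTo (MulAut.conj (stable A)) (A : Matrix (Fin 2) (Fin 2) ℤ) := fun h => by
  rw [MulAut.conj_apply, stable_mul_vec, mul_inv_cancel_right]

lemma restrictsTo_conj_stable_zpow (n : ℤ) :
    RestrictsTo (MulAut.conj (stable A ^ n)) ((A ^ n : GL2Z) : Matrix (Fin 2) (Fin 2) ℤ) := by
  have h : (MulAut.conj (stable A), A) ∈ restrictionSubgroup A := restrictsTo_conj_stable
  have := zpow_mem h n
  rw [map_zpow]
  exact this

lemma restrictsTo_conj_vec (w : ℤ × ℤ) : RestrictsTo (MulAut.conj (vec A w)) 1 := fun h => by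
  rw [MulAut.conj_apply, ← vec_add, mulVec2_one, ← vec_neg, ← vec_add]
  congr 1
  abel

lemma RestrictsTo.eq {φ ψ : MulAut (EA A)} {M : Matrix (Fin 2) (Fin 2) ℤ}
    (hφ : RestrictsTo φ M) (hψ : RestrictsTo ψ M) (h : φ (stable A) = ψ (stable A)) : φ = ψ := by
  ext1 x
  rw [eq_vec_mul_stable_zpow x, map_mul, map_mul, map_zpow, map_zpow, hφ, hψ, h]

lemma RestrictsTo.matrix_eq {φ : MulAut (EA A)} {M N : Matrix (Fin 2) (Fin 2) ℤ}
    (hM : RestrictsTo φ M) (hN : RestrictsTo φ N) : M = N := by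
  have h1 := vec_injective ((hM (1, 0)).symm.trans (hN (1, 0)))
  have h2 := vec_injective ((hM (0, 1)).symm.trans (hN (0, 1)))
  simp only [mulVec2, mul_one, mul_zero, add_zero, zero_add, Prod.mk.injEq] at h1 h2
  ext i j
  fin_cases i <;> fin_cases j <;> simp [h1, h2]

end EA

namespace IsAnosov

variable {A : GL2Z}

lemma det_eq (A : GL2Z) : (A : Matrix (Fin 2) (Fin 2) ℤ).det = 1 ∨
    (A : Matrix (Fin 2) (Fin 2) ℤ).det = -1 :=
  Int.isUnit_iff.mp ((Matrix.isUnit_iff_isUnit_det _).mp A.isUnit)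

/-- An Anosov matrix does not have eigenvalue `1`. -/
lemma one_sub_trace_add_det_ne_zero_s7 (hA : IsAnosov A) :
    1 - (A : Matrix (Fin 2) (Fin 2) ℤ).trace + (A : Matrix (Fin 2) (Fin 2) ℤ).det ≠ 0 := by
  intro h
  apply hA
  rcases det_eq A with h1 | h1
  · refine .inl ⟨h1, abs_le.mpr ?_⟩; constructor <;> linarith
  · exact .inr ⟨h1, by linarith⟩

/-- An Anosov matrix does not have eigenvalue `-1`. -/
lemma one_add_trace_add_det_ne_zero (hA : IsAnosov A) :
    1 + (A : Matrix (Fin 2) (Fin 2) ℤ).trace + (A : Matrix (Fin 2) (Fin 2) ℤ).det ≠ 0 := by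
  intro h
  apply hA
  rcases det_eq A with h1 | h1
  · refine .inl ⟨h1, abs_le.mpr ?_⟩; constructor <;> linarith
  · exact .inr ⟨h1, by linarith⟩

lemma upper_right_ne_zero (hA : IsAnosov A) : (A : Matrix (Fin 2) (Fin 2) ℤ) 0 1 ≠ 0 := by
  intro h
  have hd := det_eq A
  have h1 := hA.one_sub_trace_add_det_ne_zero_s7
  have h2 := hA.one_add_trace_add_det_ne_zero
  rw [Matrix.det_fin_two, h, zero_mul, sub_zero] at hd h1 h2
  rw [Matrix.trace_fin_two] at h1 h2
  have hu : IsUnit ((A : Matrix (Fin 2) (Fin 2) ℤ) 0 0) :=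
    isUnit_of_mul_isUnit_left (Int.isUnit_iff.mpr hd)
  rcases Int.isUnit_iff.mp hu with h0 | h0 <;> rw [h0] at h1 h2
  · exact h1 (by ring)
  · exact h2 (by ring)

/-- An Anosov matrix has real eigenvalues `x`, `y`, one of absolute value greater than `1`. -/
lemma exists_eigenvalues (hA : IsAnosov A) : ∃ x y : ℝ, 1 < |x| ∧
    x + y = (A : Matrix (Fin 2) (Fin 2) ℤ).trace ∧ x * y = (A : Matrix (Fin 2) (Fin 2) ℤ).det := by
  set t := (A : Matrix (Fin 2) (Fin 2) ℤ).trace with ht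
  set d := (A : Matrix (Fin 2) (Fin 2) ℤ).det with hd
  have hdisc : 0 ≤ t ^ 2 - 4 * d := by
    rcases det_eq A with h | h <;> rw [← hd] at h
    · have : 2 < |t| := by
        by_contra! h3
        exact hA (.inl ⟨h, h3⟩)
      rw [h, ← sq_abs]
      nlinarith
    · rw [h]; linarith [sq_nonneg t]
  have hdisc' : (0 : ℝ) ≤ (t : ℝ) ^ 2 - 4 * d := by exact_mod_cast hdisc
  have hsq := Real.sq_sqrt hdisc'
  set s := √((t : ℝ) ^ 2 - 4 * d)
  obtain ⟨x, y, hs, hp⟩ : ∃ x y : ℝ, x + y = t ∧ x * y = d :=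
    ⟨(t + s) / 2, (t - s) / 2, by ring, by linear_combination -hsq / 4⟩
  have hd1 : |(d : ℝ)| = 1 := by
    rcases det_eq A with h | h <;> rw [← hd] at h <;> simp [h]
  have hx1 : |x| ≠ 1 := by
    intro h
    rcases (abs_eq zero_le_one).mp h with h | h
    · apply hA.one_sub_trace_add_det_ne_zero_s7
      rw [← ht, ← hd]
      have : (1 - t + d : ℝ) = 0 := by rw [← hs, ← hp, h]; ring
      exact_mod_cast this
    · apply hA.one_add_trace_add_det_ne_zero
      rw [← ht, ← hd]
      have : (1 + t + d : ℝ) = 0 := by rw [← hs, ← hp, h]; ring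
      exact_mod_cast this
  rcases lt_or_gt_of_ne hx1 with h | h
  · refine ⟨y, x, ?_, by rw [add_comm, hs], by rw [mul_comm, hp]⟩
    rw [← hp, abs_mul] at hd1
    by_contra! h'
    nlinarith [abs_nonneg x, abs_nonneg y]
  · exact ⟨x, y, h, hs, hp⟩

end IsAnosov

lemma entries_of_commute {A B : GL2Z} (h : Commute A B) :
    (A : Matrix (Fin 2) (Fin 2) ℤ) 0 1 * (B : Matrix (Fin 2) (Fin 2) ℤ) 1 0 =
      (B : Matrix (Fin 2) (Fin 2) ℤ) 0 1 * (A : Matrix (Fin 2) (Fin 2) ℤ) 1 0 ∧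
    (A : Matrix (Fin 2) (Fin 2) ℤ) 0 1 * (B : Matrix (Fin 2) (Fin 2) ℤ) 1 1 =
      (A : Matrix (Fin 2) (Fin 2) ℤ) 0 1 * (B : Matrix (Fin 2) (Fin 2) ℤ) 0 0 +
      (B : Matrix (Fin 2) (Fin 2) ℤ) 0 1 *
        ((A : Matrix (Fin 2) (Fin 2) ℤ) 1 1 - (A : Matrix (Fin 2) (Fin 2) ℤ) 0 0) := by
  have h' : (A : Matrix (Fin 2) (Fin 2) ℤ) * B = B * A := by
    rw [← Units.val_mul, h.eq, Units.val_mul]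
  have h0 := congr_fun (congr_fun h' 0) 0
  have h1 := congr_fun (congr_fun h' 0) 1
  simp only [Matrix.mul_apply, Fin.sum_univ_two] at h0 h1
  constructor <;> linarith

/-- The eigenvalue of a matrix in the centralizer of `A` on the eigenvector `(1, k)` that it
shares with `A`. -/
noncomputable def centralizerEigenvalue (A : GL2Z) (k : ℝ)
    (hq : (A : Matrix (Fin 2) (Fin 2) ℤ) 0 1 ≠ 0)
    (hk : (A : Matrix (Fin 2) (Fin 2) ℤ) 0 1 * k ^ 2 = (A : Matrix (Fin 2) (Fin 2) ℤ) 1 0 +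
      ((A : Matrix (Fin 2) (Fin 2) ℤ) 1 1 - (A : Matrix (Fin 2) (Fin 2) ℤ) 0 0) * k) :
    Subgroup.centralizer {A} →* ℝ where
  toFun B := (B.1 : Matrix (Fin 2) (Fin 2) ℤ) 0 0 + (B.1 : Matrix (Fin 2) (Fin 2) ℤ) 0 1 * k
  map_one' := by simp
  map_mul' B C := by
    obtain ⟨h1, h2⟩ := entries_of_commute (A := A) (B := C.1)
      (Subgroup.mem_centralizer_singleton_iff.mp C.2).symm
    have hq' : ((A : Matrix (Fin 2) (Fin 2) ℤ) 0 1 : ℝ) ≠ 0 := by exact_mod_cast hq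
    replace h1 := congrArg (Int.cast : ℤ → ℝ) h1
    replace h2 := congrArg (Int.cast : ℤ → ℝ) h2
    push_cast at h1 h2
    apply mul_left_cancel₀ hq'
    simp only [Subgroup.coe_mul, Units.val_mul, Matrix.mul_apply, Fin.sum_univ_two]
    push_cast
    linear_combination ((B.1 : Matrix (Fin 2) (Fin 2) ℤ) 0 1 : ℝ) * h1 +
      ((B.1 : Matrix (Fin 2) (Fin 2) ℤ) 0 1 : ℝ) * k * h2 -
      ((B.1 : Matrix (Fin 2) (Fin 2) ℤ) 0 1 : ℝ) * (C.1 : Matrix (Fin 2) (Fin 2) ℤ) 0 1 * hk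

lemma finite_setOf_commute_abs_le {A : GL2Z} (hq : (A : Matrix (Fin 2) (Fin 2) ℤ) 0 1 ≠ 0)
    (K : ℝ) : {B : GL2Z | Commute A B ∧ |((B : Matrix (Fin 2) (Fin 2) ℤ) 0 0 : ℝ)| ≤ K ∧
      |((B : Matrix (Fin 2) (Fin 2) ℤ) 0 1 : ℝ)| ≤ K}.Finite := by
  have hmem (z : ℤ) (hz : |(z : ℝ)| ≤ K) : z ∈ Set.Icc (-⌈K⌉) ⌈K⌉ := by
    rw [Set.mem_Icc, ← abs_le]
    have := hz.trans (Int.le_ceil K)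
    exact_mod_cast this
  refine Set.Finite.of_injOn (t := Set.Icc (-⌈K⌉) ⌈K⌉ ×ˢ Set.Icc (-⌈K⌉) ⌈K⌉)
    (f := fun B : GL2Z => ((B : Matrix (Fin 2) (Fin 2) ℤ) 0 0, (B : Matrix (Fin 2) (Fin 2) ℤ) 0 1))
    ?_ ?_ ((Set.finite_Icc _ _).prod (Set.finite_Icc _ _))
  · rintro B ⟨-, h0, h1⟩
    exact ⟨hmem _ h0, hmem _ h1⟩
  · rintro B ⟨hB, -⟩ C ⟨hC, -⟩ h
    obtain ⟨h0, h1⟩ := Prod.mk.inj h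
    obtain ⟨hB0, hB1⟩ := entries_of_commute hB
    obtain ⟨hC0, hC1⟩ := entries_of_commute hC
    have h2 := mul_left_cancel₀ hq (hB0.trans ((by rw [h1] : _ = _).trans hC0.symm))
    have h3 := mul_left_cancel₀ hq (hB1.trans ((by rw [h0, h1] : _ = _).trans hC1.symm))
    ext i j
    fin_cases i <;> fin_cases j <;> assumption

/-- The powers of an Anosov matrix have finite index in its centralizer. -/
lemma IsAnosov.exists_finite_zpow_mul_mem {A : GL2Z} (hA : IsAnosov A) :
    ∃ S : Set GL2Z, S.Finite ∧ ∀ B, Commute A B → ∃ n : ℤ, A ^ n * B ∈ S := by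
  obtain ⟨x, y, hx, hs, hp⟩ := hA.exists_eigenvalues
  have hq := hA.upper_right_ne_zero
  have hq' : ((A : Matrix (Fin 2) (Fin 2) ℤ) 0 1 : ℝ) ≠ 0 := by exact_mod_cast hq
  rw [Matrix.trace_fin_two] at hs
  have hdet : |x * y| = 1 := by
    rw [hp]
    rcases IsAnosov.det_eq A with h | h <;> simp [h]
  rw [Matrix.det_fin_two] at hp
  push_cast at hs hp
  set p : ℝ := ((A : Matrix (Fin 2) (Fin 2) ℤ) 0 0 : ℝ) with hpdef
  set q : ℝ := ((A : Matrix (Fin 2) (Fin 2) ℤ) 0 1 : ℝ) with hqdef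
  set r : ℝ := ((A : Matrix (Fin 2) (Fin 2) ℤ) 1 0 : ℝ) with hrdef
  set s : ℝ := ((A : Matrix (Fin 2) (Fin 2) ℤ) 1 1 : ℝ) with hsdef
  obtain ⟨k, hk⟩ : ∃ k, q * k = x - p := ⟨(x - p) / q, by field_simp⟩
  obtain ⟨l, hl⟩ : ∃ l, q * l = y - p := ⟨(y - p) / q, by field_simp⟩
  have hk2 : q * k ^ 2 = r + (s - p) * k := by
    apply mul_left_cancel₀ hq'
    linear_combination (q * k + x - p - (s - p)) * hk + x * hs - hp
  have hkl : q * (k + l) = s - p := by linear_combination hk + hl + hs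
  have hklm : q * (k * l) = -r := by linear_combination k * hkl - hk2
  have hne : k ≠ l := by
    rintro rfl
    have hxy : x = y := by linear_combination hl - hk
    rw [← hxy, abs_mul] at hdet
    nlinarith
  have hx0 : 0 < |x| := by linarith
  let Λ := centralizerEigenvalue A k hq hk2
  have hΛ (B) : Λ B = (B.1 : Matrix (Fin 2) (Fin 2) ℤ) 0 0 +
    (B.1 : Matrix (Fin 2) (Fin 2) ℤ) 0 1 * k := rfl
  let a : Subgroup.centralizer {A} := ⟨A, Subgroup.mem_centralizer_singleton_iff.mpr rfl⟩
  have hΛa : Λ a = x := by rw [hΛ]; linear_combination hk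
  have hΛz (n : ℤ) : Λ (a ^ n) = x ^ n := by
    rw [← MonoidHom.coe_toHomUnits, map_zpow, Units.val_zpow_eq_zpow_val,
      MonoidHom.coe_toHomUnits, hΛa]
  set b := (|x| + 1) / |k - l|
  set K := |x| + b * |k| + b
  have hb : 0 ≤ b := by positivity
  refine ⟨_, finite_setOf_commute_abs_le hq K, fun B hB => ?_⟩
  let B' : Subgroup.centralizer {A} := ⟨B, Subgroup.mem_centralizer_singleton_iff.mpr hB.symm⟩
  have hpos : 0 < |Λ B'| := by
    rw [abs_pos, ← MonoidHom.coe_toHomUnits]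
    exact Units.ne_zero _
  obtain ⟨n, hn⟩ := exists_mem_Ico_zpow hpos hx
  refine ⟨-n, ((Commute.refl A).zpow_right _).mul_right hB, ?_⟩
  set C := A ^ (-n) * B with hC
  have hcomm : Commute A C := ((Commute.refl A).zpow_right _).mul_right hB
  have hΛC : Λ (a ^ (-n) * B') = (C : Matrix (Fin 2) (Fin 2) ℤ) 0 0 +
    (C : Matrix (Fin 2) (Fin 2) ℤ) 0 1 * k := rfl
  rw [map_mul, hΛz] at hΛC
  obtain ⟨h0, h1⟩ := entries_of_commute hcomm
  have hdetC : |((C : Matrix (Fin 2) (Fin 2) ℤ).det : ℝ)| = 1 := by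
    rcases IsAnosov.det_eq C with h | h <;> simp [h]
  rw [Matrix.det_fin_two] at hdetC
  replace h0 := congrArg (Int.cast : ℤ → ℝ) h0
  replace h1 := congrArg (Int.cast : ℤ → ℝ) h1
  push_cast at h0 h1 hdetC
  rw [← hqdef, ← hrdef] at h0
  rw [← hqdef, ← hsdef, ← hpdef] at h1
  set α : ℝ := ((C : Matrix (Fin 2) (Fin 2) ℤ) 0 0 : ℝ)
  set β : ℝ := ((C : Matrix (Fin 2) (Fin 2) ℤ) 0 1 : ℝ)
  set γ : ℝ := ((C : Matrix (Fin 2) (Fin 2) ℤ) 1 0 : ℝ)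
  set δ : ℝ := ((C : Matrix (Fin 2) (Fin 2) ℤ) 1 1 : ℝ)
  have hnorm : (α + β * k) * (α + β * l) = α * δ - β * γ := by
    apply mul_left_cancel₀ hq'
    linear_combination α * β * hkl + β ^ 2 * hklm - α * h1 + β * h0
  have habs : |α + β * k| = |x| ^ (-n) * |Λ B'| := by
    rw [← hΛC, abs_mul, abs_zpow]
  have hxn : 0 < |x| ^ n := zpow_pos hx0 n
  have hlow : 1 ≤ |α + β * k| := by
    rw [habs, _root_.zpow_neg, inv_mul_eq_div, one_le_div hxn]
    exact hn.1
  have hup : |α + β * k| ≤ |x| := by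
    rw [habs, _root_.zpow_neg, inv_mul_eq_div, div_le_iff₀ hxn, mul_comm, ← zpow_add_one₀ hx0.ne']
    exact hn.2.le
  have hconj : |α + β * l| ≤ 1 := by
    rw [← hnorm, abs_mul] at hdetC
    by_contra! h
    nlinarith
  have hβ : |β| ≤ b := by
    rw [le_div_iff₀ (abs_pos.mpr (sub_ne_zero.mpr hne)), ← abs_mul]
    calc |β * (k - l)| = |(α + β * k) - (α + β * l)| := by ring_nf
      _ ≤ |α + β * k| + |α + β * l| := abs_sub _ _
      _ ≤ |x| + 1 := add_le_add hup hconj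
  have hα : |α| ≤ |x| + b * |k| := by
    calc |α| = |(α + β * k) - β * k| := by ring_nf
      _ ≤ |α + β * k| + |β * k| := abs_sub _ _
      _ ≤ |x| + b * |k| := by rw [abs_mul]; gcongr
  have : 0 ≤ b * |k| := by positivity
  exact ⟨by linarith, by linarith⟩

namespace EA

variable {A : GL2Z}

/-- For `A` Anosov, the subgroup `ℤ × ℤ` of `E_A` is characteristic. -/
lemma map_vec_right (hA : IsAnosov A) (φ : MulAut (EA A)) (h : ℤ × ℤ) :
    (φ (vec A h)).right = 1 := by
  have hD := hA.one_sub_trace_add_det_ne_zero_s7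
  rw [Matrix.trace_fin_two, Matrix.det_fin_two] at hD
  let f : ℤ × ℤ →+ ℤ :=
    { toFun := fun h => toAdd (φ (vec A h)).right
      map_zero' := by simp [vec]
      map_add' := fun h k => by rw [vec_add, map_mul, mul_right, toAdd_mul] }
  have hf (h) : f (mulVec2 (A : Matrix (Fin 2) (Fin 2) ℤ) h) = f h := by
    have := congrArg (fun x => toAdd (φ x).right) (stable_mul_vec (A := A) h)
    simp only [map_mul, mul_right, toAdd_mul] at this
    change _ + f h = f _ + _ at this
    linarith
  set M := (A : Matrix (Fin 2) (Fin 2) ℤ)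
  have hfe (h : ℤ × ℤ) : f h = h.1 * f (1, 0) + h.2 * f (0, 1) := by
    rw [← smul_eq_mul, ← smul_eq_mul, ← map_zsmul, ← map_zsmul, ← map_add]
    congr 1
    ext <;> simp
  have h1 := hf (1, 0)
  have h2 := hf (0, 1)
  rw [hfe (mulVec2 _ _)] at h1 h2
  simp only [mulVec2, mul_one, mul_zero, add_zero, zero_add] at h1 h2
  have h3 : f (1, 0) = 0 := by
    refine (mul_eq_zero.mp ?_).resolve_left hD
    linear_combination (M 1 1 - 1) * h1 - M 1 0 * h2
  have h4 : f (0, 1) = 0 := by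
    refine (mul_eq_zero.mp ?_).resolve_left hD
    linear_combination (M 0 0 - 1) * h2 - M 0 1 * h1
  have : f h = 0 := by rw [hfe, h3, h4]; simp
  exact toAdd.injective this

lemma exists_restrictsTo_matrix (hA : IsAnosov A) (φ : MulAut (EA A)) :
    ∃ M : Matrix (Fin 2) (Fin 2) ℤ, RestrictsTo φ M := by
  let f : ℤ × ℤ →+ ℤ × ℤ := AddMonoidHom.mk' (fun h => toAdd (φ (vec A h)).left) fun h k =>
    vec_injective (A := A) <| by
      rw [vec_add (toAdd _), ← eq_vec_of_right_eq_one (map_vec_right hA φ _),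
        ← eq_vec_of_right_eq_one (map_vec_right hA φ _),
        ← eq_vec_of_right_eq_one (map_vec_right hA φ _), vec_add, map_mul]
  have hf (h) : φ (vec A h) = vec A (f h) := eq_vec_of_right_eq_one (map_vec_right hA φ h)
  refine ⟨!![(f (1, 0)).1, (f (0, 1)).1; (f (1, 0)).2, (f (0, 1)).2], fun h => ?_⟩
  have hh : h = h.1 • (1, 0) + h.2 • (0, 1) := by ext <;> simp
  rw [hf]
  congr 1
  conv_lhs => rw [hh, map_add, map_zsmul, map_zsmul]
  ext <;> simp [mulVec2, mul_comm]

lemma exists_restrictsTo (hA : IsAnosov A) (φ : MulAut (EA A)) :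
    ∃ B : GL2Z, RestrictsTo φ (B : Matrix (Fin 2) (Fin 2) ℤ) := by
  obtain ⟨M, hM⟩ := exists_restrictsTo_matrix hA φ
  obtain ⟨N, hN⟩ := exists_restrictsTo_matrix hA φ⁻¹
  have h1 : RestrictsTo (1 : MulAut (EA A)) 1 := fun h => by simp [mulVec2_one]
  have hMN := hM.mul hN
  have hNM := hN.mul hM
  rw [mul_inv_cancel] at hMN
  rw [inv_mul_cancel] at hNM
  exact ⟨⟨M, N, hMN.matrix_eq h1, hNM.matrix_eq h1⟩, hM⟩

lemma toAdd_map_right (hA : IsAnosov A) (φ : MulAut (EA A)) (x : EA A) :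
    toAdd (φ x).right = toAdd x.right * toAdd (φ (stable A)).right := by
  conv_lhs => rw [eq_vec_mul_stable_zpow x, map_mul, map_zpow, mul_right, map_vec_right hA, one_mul,
    ← rightHom_eq_right, map_zpow, toAdd_zpow, smul_eq_mul, rightHom_eq_right]

lemma toAdd_map_stable_right (hA : IsAnosov A) (φ : MulAut (EA A)) :
    toAdd (φ (stable A)).right = 1 ∨ toAdd (φ (stable A)).right = -1 := by
  have := toAdd_map_right hA φ (φ⁻¹ (stable A))
  rw [MulAut.apply_inv_self, stable_right, toAdd_ofAdd] at this
  exact Int.isUnit_iff.mp (IsUnit.of_mul_eq_one _ ((mul_comm _ _).trans this.symm))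

lemma eq_vec_mul_stable {x : EA A} (hx : toAdd x.right = 1) :
    x = vec A (toAdd x.left) * stable A := by
  conv_lhs => rw [eq_vec_mul_stable_zpow x, hx, zpow_one]

lemma RestrictsTo.commute {φ : MulAut (EA A)} {B : GL2Z}
    (hB : RestrictsTo φ (B : Matrix (Fin 2) (Fin 2) ℤ))
    (hφ : toAdd (φ (stable A)).right = 1) : Commute A B := by
  have h1 := hB.mul restrictsTo_conj_stable
  have h2 : RestrictsTo (φ * MulAut.conj (stable A))
      ((A : Matrix (Fin 2) (Fin 2) ℤ) * (B : Matrix (Fin 2) (Fin 2) ℤ)) := fun h => by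
    rw [MulAut.mul_apply, MulAut.conj_apply, map_mul, map_mul, map_inv, eq_vec_mul_stable hφ, hB,
      mul_assoc (vec A _), stable_mul_vec, ← mulVec2_mul, ← mul_assoc, ← vec_add, add_comm, vec_add,
      mul_assoc (vec A _), mul_inv_cancel_right]
  exact Units.ext (h2.matrix_eq h1)

lemma exists_conj_vec_stable (hA : IsAnosov A) (v : ℤ × ℤ) :
    ∃ w, ∃ u ∈ Set.Icc 0 |1 - (A : Matrix (Fin 2) (Fin 2) ℤ).trace +
        (A : Matrix (Fin 2) (Fin 2) ℤ).det| ×ˢ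
      Set.Icc 0 |1 - (A : Matrix (Fin 2) (Fin 2) ℤ).trace + (A : Matrix (Fin 2) (Fin 2) ℤ).det|,
      MulAut.conj (vec A w) (vec A v * stable A) = vec A u * stable A := by
  have hD := hA.one_sub_trace_add_det_ne_zero_s7
  set D := 1 - (A : Matrix (Fin 2) (Fin 2) ℤ).trace + (A : Matrix (Fin 2) (Fin 2) ℤ).det with hDdef
  rw [Matrix.trace_fin_two, Matrix.det_fin_two] at hDdef
  set M := (A : Matrix (Fin 2) (Fin 2) ℤ) with hM
  refine ⟨-((1 - M 1 1) * (v.1 / D) + M 0 1 * (v.2 / D),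
    M 1 0 * (v.1 / D) + (1 - M 0 0) * (v.2 / D)), (v.1 % D, v.2 % D),
    ⟨⟨Int.emod_nonneg _ hD, (Int.emod_lt_abs _ hD).le⟩,
      ⟨Int.emod_nonneg _ hD, (Int.emod_lt_abs _ hD).le⟩⟩, ?_⟩
  rw [MulAut.conj_apply, ← vec_neg, mul_assoc, mul_assoc, stable_mul_vec, ← mul_assoc, ← mul_assoc,
    ← vec_add, ← vec_add, ← hM]
  congr 2
  have e1 := Int.emod_add_mul_ediv v.1 D
  have e2 := Int.emod_add_mul_ediv v.2 D
  ext
  · simp only [mulVec2, Prod.fst_add, Prod.fst_neg, Prod.snd_neg]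
    linear_combination -e1 + (v.1 / D) * hDdef
  · simp only [mulVec2, Prod.snd_add, Prod.fst_neg, Prod.snd_neg]
    linear_combination -e2 + (v.2 / D) * hDdef

lemma exists_finite_conj_mul_mem (hA : IsAnosov A) :
    ∃ S : Set (MulAut (EA A)), S.Finite ∧
      ∀ φ : MulAut (EA A), toAdd (φ (stable A)).right = 1 → ∃ g, MulAut.conj g * φ ∈ S := by
  obtain ⟨T, hT, hTA⟩ := hA.exists_finite_zpow_mul_mem
  have hbox := (Set.finite_Icc (0 : ℤ) |1 - (A : Matrix (Fin 2) (Fin 2) ℤ).trace +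
    (A : Matrix (Fin 2) (Fin 2) ℤ).det|)
  refine ⟨_, (hT.prod (hbox.prod hbox)).biUnion (t := fun x => {φ : MulAut (EA A) |
    RestrictsTo φ (x.1 : Matrix (Fin 2) (Fin 2) ℤ) ∧ φ (stable A) = vec A x.2 * stable A})
    fun x _ => Set.Subsingleton.finite ?_, fun φ hφ => ?_⟩
  · rintro φ ⟨h1, h2⟩ ψ ⟨h3, h4⟩
    exact h1.eq h3 (h2.trans h4.symm)
  · obtain ⟨B, hB⟩ := exists_restrictsTo hA φ
    obtain ⟨n, hn⟩ := hTA B (hB.commute hφ)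
    have h1 := (restrictsTo_conj_stable_zpow n).mul hB
    have h2 : toAdd ((MulAut.conj (stable A ^ n) * φ) (stable A)).right = 1 := by
      rw [MulAut.mul_apply, MulAut.conj_apply, mul_right, mul_right, inv_right, mul_inv_cancel_comm, hφ]
    obtain ⟨w, u, hu, hw⟩ := exists_conj_vec_stable hA
      (toAdd ((MulAut.conj (stable A ^ n) * φ) (stable A)).left)
    rw [← eq_vec_mul_stable h2] at hw
    refine ⟨vec A w * stable A ^ n, Set.mem_biUnion (x := (A ^ n * B, u)) ⟨hn, hu⟩ ⟨?_, ?_⟩⟩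
    · have := (restrictsTo_conj_vec w).mul h1
      rwa [one_mul, ← mul_assoc, ← map_mul] at this
    · rw [map_mul, mul_assoc]
      exact hw

end EA

/-- For `A` Anosov, `Out(E_A) = Aut(E_A)/Inn(E_A)` is finite. -/
theorem stmt7 (A : GL2Z) (hA : IsAnosov A) : Finite (OutG (EA A)) := by
  have hmk (g : EA A) (φ : MulAut (EA A)) :
      (QuotientGroup.mk (MulAut.conj g * φ) : OutG (EA A)) = QuotientGroup.mk φ := by
    rw [QuotientGroup.mk_mul, (QuotientGroup.eq_one_iff _).mpr (MonoidHom.mem_range.mpr ⟨g, rfl⟩), one_mul]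
  obtain ⟨S, hS, hSA⟩ := EA.exists_finite_conj_mul_mem hA
  set Q : Set (OutG (EA A)) := QuotientGroup.mk '' S
  have hQ : Q.Finite := hS.image _
  have hpos (φ : MulAut (EA A)) (hφ : toAdd (φ (EA.stable A)).right = 1) :
      (QuotientGroup.mk φ : OutG (EA A)) ∈ Q := by
    obtain ⟨g, hg⟩ := hSA φ hφ
    exact ⟨_, hg, hmk g φ⟩
  rw [← Set.finite_univ_iff]
  by_cases h : ∃ ψ : MulAut (EA A), toAdd (ψ (EA.stable A)).right = -1
  · obtain ⟨ψ, hψ⟩ := h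
    refine (hQ.union (hQ.image (fun x => (QuotientGroup.mk ψ : OutG (EA A))⁻¹ * x))).subset
      fun x _ => ?_
    obtain ⟨φ, rfl⟩ := QuotientGroup.mk_surjective x
    rcases EA.toAdd_map_stable_right hA φ with hφ | hφ
    · exact .inl (hpos φ hφ)
    · refine .inr ⟨_, hpos (ψ * φ) ?_, ?_⟩
      · rw [MulAut.mul_apply, EA.toAdd_map_right hA, hφ, hψ]; rfl
      · rw [QuotientGroup.mk_mul]
        exact inv_mul_cancel_left _ _
  · refine hQ.subset fun x _ => ?_
    obtain ⟨φ, rfl⟩ := QuotientGroup.mk_surjective x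
    exact hpos φ ((EA.toAdd_map_stable_right hA φ).resolve_right fun hφ => h ⟨φ, hφ⟩)
end
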